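/- For λ ∈ (1,2) and P < 0, the period T₋(P) is a strictly increasing function of -P, with lim_{P→-∞} T₋(P) = π/λ. -/

import Mathlib

open Real MeasureTheory

/-- The integrand of the period, with `c` in the place of `x₋(P) ^ (-2 / λ)`. -/
noncomputable def periodIntegrand (lam c s : ℝ) : ℝ :=
  2 / Real.sqrt (lam ^ 2 * (1 - s ^ 2) + c * (1 - s ^ (2 - 2 / lam)))

lemma measurable_periodIntegrand (lam c : ℝ) : Measurable (periodIntegrand lam c) := by
  unfold periodIntegrand
  fun_prop

lemma periodIntegrand_nonneg (lam c s : ℝ) : 0 ≤ periodIntegrand lam c s := by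
  unfold periodIntegrand
  positivity

lemma one_sub_sq_pos {s : ℝ} (hs : s ∈ Set.Ioo (0 : ℝ) 1) : 0 < 1 - s ^ 2 := by
  nlinarith [hs.1, hs.2]

lemma one_sub_rpow_pos {lam s : ℝ} (hlam : 1 < lam) (hs : s ∈ Set.Ioo (0 : ℝ) 1) :
    0 < 1 - s ^ (2 - 2 / lam) := by
  have h : 2 / lam < 2 := by
    rw [div_lt_iff₀ (by linarith)]
    linarith
  have := Real.rpow_lt_one hs.1.le hs.2 (sub_pos.2 h)
  linarith

lemma periodIntegrand_strictAntiOn {lam s : ℝ} (hlam : 1 < lam) (hs : s ∈ Set.Ioo (0 : ℝ) 1) :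
    StrictAntiOn (fun c => periodIntegrand lam c s) (Set.Ici 0) := by
  intro c hc d _ hcd
  have h1 := one_sub_sq_pos hs
  have h2 := one_sub_rpow_pos hlam hs
  have hc' : 0 ≤ c := hc
  have h3 : 0 < lam ^ 2 * (1 - s ^ 2) + c * (1 - s ^ (2 - 2 / lam)) := by positivity
  exact div_lt_div_of_pos_left two_pos (Real.sqrt_pos.2 h3)
    (Real.sqrt_lt_sqrt h3.le (by gcongr))

lemma hasDerivAt_two_div_mul_arcsin {lam s : ℝ} (hlam : 1 < lam) (hs : s ∈ Set.Ioo (0 : ℝ) 1) :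
    HasDerivAt (fun t => 2 / lam * Real.arcsin t) (periodIntegrand lam 0 s) s := by
  have hpos : 0 < lam := by linarith
  have hsqrt := (Real.sqrt_pos.2 (one_sub_sq_pos hs)).ne'
  have h : periodIntegrand lam 0 s = 2 / lam * (1 / Real.sqrt (1 - s ^ 2)) := by
    rw [periodIntegrand, zero_mul, add_zero, Real.sqrt_mul (by positivity), Real.sqrt_sq hpos.le]
    field_simp
  rw [h]
  exact (Real.hasDerivAt_arcsin (by linarith [hs.1]) hs.2.ne).const_mul (2 / lam)

lemma intervalIntegrable_periodIntegrand_zero {lam : ℝ} (hlam : 1 < lam) :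
    IntervalIntegrable (periodIntegrand lam 0) volume 0 1 := by
  rw [intervalIntegrable_iff_integrableOn_Ioc_of_le zero_le_one]
  exact intervalIntegral.integrableOn_deriv_of_nonneg
    (continuous_const.mul Real.continuous_arcsin).continuousOn
    (fun s hs => hasDerivAt_two_div_mul_arcsin hlam hs) (fun s _ => periodIntegrand_nonneg _ _ s)

lemma integrableOn_periodIntegrand {lam c : ℝ} (hlam : 1 < lam) (hc : 0 ≤ c) :
    IntegrableOn (periodIntegrand lam c) (Set.Ioo 0 1) := by
  have h0 : IntegrableOn (periodIntegrand lam 0) (Set.Ioo 0 1) :=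
    (intervalIntegrable_iff_integrableOn_Ioo_of_le zero_le_one).1
      (intervalIntegrable_periodIntegrand_zero hlam)
  refine Integrable.mono' h0 (measurable_periodIntegrand lam c).aestronglyMeasurable ?_
  filter_upwards [ae_restrict_mem measurableSet_Ioo] with s hs
  rw [Real.norm_of_nonneg (periodIntegrand_nonneg _ _ _)]
  exact (periodIntegrand_strictAntiOn hlam hs).antitoneOn Set.self_mem_Ici hc hc

lemma integral_periodIntegrand_zero {lam : ℝ} (hlam : 1 < lam) :
    ∫ s in Set.Ioo (0 : ℝ) 1, periodIntegrand lam 0 s = π / lam := by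
  rw [← integral_Ioc_eq_integral_Ioo, ← intervalIntegral.integral_of_le zero_le_one,
    intervalIntegral.integral_eq_sub_of_hasDerivAt_of_le (f := fun t => 2 / lam * Real.arcsin t)
      zero_le_one
      (continuous_const.mul Real.continuous_arcsin).continuousOn
      (fun s hs => hasDerivAt_two_div_mul_arcsin hlam hs)
      (intervalIntegrable_periodIntegrand_zero hlam)]
  simp only [Real.arcsin_one, Real.arcsin_zero]
  ring

lemma integral_periodIntegrand_strictAntiOn {lam : ℝ} (hlam : 1 < lam) :
    StrictAntiOn (fun c => ∫ s in Set.Ioo (0 : ℝ) 1, periodIntegrand lam c s) (Set.Ici 0) := by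
  intro c hc d hd hcd
  have hic := integrableOn_periodIntegrand hlam hc
  have hid := integrableOn_periodIntegrand hlam hd
  have hpos : 0 < ∫ s in (0 : ℝ)..1, (periodIntegrand lam c s - periodIntegrand lam d s) :=
    intervalIntegral.intervalIntegral_pos_of_pos_on
      ((intervalIntegrable_iff_integrableOn_Ioo_of_le zero_le_one).2 (hic.sub hid))
      (fun s hs => sub_pos.2 (periodIntegrand_strictAntiOn hlam hs hc hd hcd)) one_pos
  rw [intervalIntegral.integral_of_le zero_le_one, integral_Ioc_eq_integral_Ioo,
    integral_sub hic hid] at hpos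
  exact sub_pos.1 hpos

lemma tendsto_integral_periodIntegrand {lam : ℝ} (hlam : 1 < lam) :
    Filter.Tendsto (fun c => ∫ s in Set.Ioo (0 : ℝ) 1, periodIntegrand lam c s)
      (nhdsWithin 0 (Set.Ici 0)) (nhds (π / lam)) := by
  rw [← integral_periodIntegrand_zero hlam]
  refine tendsto_integral_filter_of_dominated_convergence (periodIntegrand lam 0)
    (.of_forall fun c => (measurable_periodIntegrand lam c).aestronglyMeasurable) ?_
    (integrableOn_periodIntegrand hlam le_rfl) ?_
  · filter_upwards [self_mem_nhdsWithin] with c hc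
    filter_upwards [ae_restrict_mem measurableSet_Ioo] with s hs
    rw [Real.norm_of_nonneg (periodIntegrand_nonneg _ _ _)]
    exact (periodIntegrand_strictAntiOn hlam hs).antitoneOn Set.self_mem_Ici hc hc
  · filter_upwards [ae_restrict_mem measurableSet_Ioo] with s hs
    have hlam0 : 0 < lam := by linarith
    have h1 := one_sub_sq_pos hs
    refine ContinuousAt.continuousWithinAt (ContinuousAt.div (by fun_prop) (by fun_prop) ?_)
    rw [zero_mul, add_zero]
    positivity

/-- For λ ∈ (1,2), the period `T₋(P)` is a strictly increasing function of -P
(i.e. strictly antitone in P on (-∞,0)), and `T₋(P) → π/λ` as `P → -∞`. -/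
theorem stmt_12 (lam : ℝ) (hlam : 1 < lam) (hlam2 : lam < 2)
    (x T : ℝ → ℝ)
    (hx : ∀ P < (0 : ℝ), 0 < x P ∧
      lam ^ 2 * (x P) ^ 2 + (x P) ^ (2 - 2 / lam) = -2 * P)
    (hT : ∀ P < (0 : ℝ), T P = ∫ s in Set.Ioo (0:ℝ) 1,
      2 / Real.sqrt (lam ^ 2 * (1 - s ^ 2)
        + (x P) ^ (-2 / lam) * (1 - s ^ (2 - 2 / lam)))) :
    StrictAntiOn T (Set.Iio 0) ∧
    Filter.Tendsto T Filter.atBot (nhds (π / lam)) := by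
  have hlam0 : 0 < lam := by linarith
  have hexp : 0 < 2 - 2 / lam := by
    rw [sub_pos, div_lt_iff₀ hlam0]
    linarith
  have energy_mono : ∀ P < (0 : ℝ), ∀ y, x P ≤ y →
      -2 * P ≤ lam ^ 2 * y ^ 2 + y ^ (2 - 2 / lam) := by
    intro P hP y hy
    obtain ⟨hpos, heq⟩ := hx P hP
    rw [← heq]
    gcongr
  have x_anti : ∀ P Q : ℝ, P < Q → Q < 0 → x Q < x P := by
    intro P Q hPQ hQ
    by_contra! h
    have := energy_mono P (hPQ.trans hQ) _ h
    linarith [(hx Q hQ).2]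
  have x_tendsto : Filter.Tendsto x Filter.atBot Filter.atTop := by
    refine Filter.tendsto_atTop.2 fun M => ?_
    filter_upwards [Filter.eventually_lt_atBot (0 : ℝ),
      Filter.eventually_lt_atBot (-(lam ^ 2 * M ^ 2 + M ^ (2 - 2 / lam)) / 2)] with P hP hPM
    by_contra! h
    linarith [energy_mono P hP M h.le]
  have T_eq : ∀ P < (0 : ℝ),
      T P = ∫ s in Set.Ioo (0 : ℝ) 1, periodIntegrand lam (x P ^ (-2 / lam)) s := hT
  have hneg : -2 / lam < 0 := div_neg_of_neg_of_pos (by norm_num) hlam0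
  constructor
  · intro P hP Q hQ hPQ
    rw [T_eq P hP, T_eq Q hQ]
    exact integral_periodIntegrand_strictAntiOn hlam
      (Real.rpow_nonneg (hx P hP).1.le _) (Real.rpow_nonneg (hx Q hQ).1.le _)
      (Real.rpow_lt_rpow_of_neg (hx Q hQ).1 (x_anti P Q hPQ hQ) hneg)
  · have hc : Filter.Tendsto (fun P => x P ^ (-2 / lam)) Filter.atBot
        (nhdsWithin 0 (Set.Ici 0)) := by
      refine tendsto_nhdsWithin_iff.2 ⟨?_, ?_⟩
      · have h := (tendsto_rpow_neg_atTop (neg_pos.2 hneg)).comp x_tendsto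
        rwa [neg_neg] at h
      · filter_upwards [Filter.eventually_lt_atBot (0 : ℝ)] with P hP
        exact Real.rpow_nonneg (hx P hP).1.le _
    refine ((tendsto_integral_periodIntegrand hlam).comp hc).congr' ?_
    filter_upwards [Filter.eventually_lt_atBot (0 : ℝ)] with P hP
    exact (T_eq P hP).symm
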